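/- arXiv:1207.5229 — 2 statements merged into one kernel-verified Lean document; each statement's English description precedes it below -/
import Mathlib

section
/- The graph cohomology ring H*_T(𝒢₂) is generated as a ring by the seven elements τ₁, τ₂, τ₃, t₁, t₂, t₃ and f. -/
open MvPolynomial Equiv

abbrev R3 := MvPolynomial (Fin 3) ℤ

noncomputable def sv (i : Fin 3) : R3 := X i - X (i + 1)

abbrev V2 := Perm (Fin 3) × Bool

/-- The GKM condition for the labeled graph `𝒢₂` of the flag manifold of type `G₂`:
`true` plays the role of `+` and `false` of `−`. -/
def gkm (h : V2 → R3) : Prop :=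
  ∀ (v₁ v₂ : Perm (Fin 3)) (ε₁ ε₂ : Bool) (i j : Fin 3), i ≠ j →
    v₁ = v₂ * Equiv.swap i j →
      (ε₁ = ε₂ → sv (v₁ i) - sv (v₁ j) ∣ h (v₁, ε₁) - h (v₂, ε₂)) ∧
      (ε₁ ≠ ε₂ → ∀ k, k ≠ i → k ≠ j → sv (v₁ k) ∣ h (v₁, ε₁) - h (v₂, ε₂))

noncomputable def tauG (i : Fin 3) : V2 → R3 := fun w => if w.2 then sv (w.1 i) else -sv (w.1 i)
noncomputable def tG (i : Fin 3) : V2 → R3 := fun _ => X i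
noncomputable def fG : V2 → R3 := fun w => if w.2 then sv 0 * sv 1 * sv 2 else 0

/-- The graph cohomology ring `H*_T(𝒢₂)`, as a subring of `∏_{w ∈ V} R`. -/
noncomputable def HTG2 : Subring (V2 → R3) where
  carrier := {h | gkm h}
  zero_mem' := by
    intro v₁ v₂ ε₁ ε₂ i j _ _
    refine ⟨fun _ => ?_, fun _ k _ _ => ?_⟩ <;> simp
  one_mem' := by
    intro v₁ v₂ ε₁ ε₂ i j _ _
    refine ⟨fun _ => ?_, fun _ k _ _ => ?_⟩ <;> simp
  add_mem' := by
    intro a b ha hb v₁ v₂ ε₁ ε₂ i j hij hv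
    obtain ⟨ha1, ha2⟩ := ha v₁ v₂ ε₁ ε₂ i j hij hv
    obtain ⟨hb1, hb2⟩ := hb v₁ v₂ ε₁ ε₂ i j hij hv
    have key : (a + b) (v₁, ε₁) - (a + b) (v₂, ε₂)
        = (a (v₁, ε₁) - a (v₂, ε₂)) + (b (v₁, ε₁) - b (v₂, ε₂)) := by
      simp only [Pi.add_apply]; ring
    refine ⟨fun he => ?_, fun he k hk1 hk2 => ?_⟩
    · rw [key]; exact dvd_add (ha1 he) (hb1 he)
    · rw [key]; exact dvd_add (ha2 he k hk1 hk2) (hb2 he k hk1 hk2)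
  neg_mem' := by
    intro a ha v₁ v₂ ε₁ ε₂ i j hij hv
    obtain ⟨ha1, ha2⟩ := ha v₁ v₂ ε₁ ε₂ i j hij hv
    have key : (-a) (v₁, ε₁) - (-a) (v₂, ε₂) = -(a (v₁, ε₁) - a (v₂, ε₂)) := by
      simp only [Pi.neg_apply]; ring
    refine ⟨fun he => ?_, fun he k hk1 hk2 => ?_⟩
    · rw [key]; exact (dvd_neg).mpr (ha1 he)
    · rw [key]; exact (dvd_neg).mpr (ha2 he k hk1 hk2)
  mul_mem' := by
    intro a b ha hb v₁ v₂ ε₁ ε₂ i j hij hv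
    obtain ⟨ha1, ha2⟩ := ha v₁ v₂ ε₁ ε₂ i j hij hv
    obtain ⟨hb1, hb2⟩ := hb v₁ v₂ ε₁ ε₂ i j hij hv
    have key : (a * b) (v₁, ε₁) - (a * b) (v₂, ε₂)
        = a (v₁, ε₁) * (b (v₁, ε₁) - b (v₂, ε₂)) + (a (v₁, ε₁) - a (v₂, ε₂)) * b (v₂, ε₂) := by
      simp only [Pi.mul_apply]; ring
    refine ⟨fun he => ?_, fun he k hk1 hk2 => ?_⟩
    · rw [key]; exact dvd_add ((hb1 he).mul_left _) ((ha1 he).mul_right _)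
    · rw [key]; exact dvd_add ((hb2 he k hk1 hk2).mul_left _) ((ha2 he k hk1 hk2).mul_right _)


/-- A polynomial `p` such that `R/(p)` embeds in `R` via a retraction `φ` is prime. -/
lemma prime_of_retraction (p : R3) (φ : R3 →ₐ[ℤ] R3) (h0 : p ≠ 0) (hp : φ p = 0)
    (hX : ∀ i, p ∣ X i - φ (X i)) : Prime p := by
  have key : ∀ u : R3, p ∣ u - φ u := by
    intro u
    induction u using MvPolynomial.induction_on with
    | C a =>
      have : φ (C a) = C a := by
        have := φ.commutes a
        simp
      rw [this]; simp
    | add a b ha hb =>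
      have e : a + b - φ (a + b) = (a - φ a) + (b - φ b) := by rw [map_add]; ring
      rw [e]; exact dvd_add ha hb
    | mul_X a i ha =>
      have e : a * X i - φ (a * X i) = a * (X i - φ (X i)) + (a - φ a) * φ (X i) := by
        rw [map_mul]; ring
      rw [e]; exact dvd_add ((hX i).mul_left _) (ha.mul_right _)
  have iff0 : ∀ u : R3, φ u = 0 → p ∣ u := by
    intro u hu
    have := key u
    rwa [hu, sub_zero] at this
  refine ⟨h0, ?_, ?_⟩
  · intro hu
    have := hu.map φ
    rw [hp] at this
    exact not_isUnit_zero this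
  · rintro a b ⟨c, hc⟩
    have : φ a * φ b = 0 := by rw [← map_mul, hc, map_mul, hp, zero_mul]
    rcases mul_eq_zero.mp this with h | h
    · exact Or.inl (iff0 a h)
    · exact Or.inr (iff0 b h)

lemma not_dvd_of_eval {p q : R3} (x : Fin 3 → ℤ) (hp : eval x p = 0) (hq : eval x q ≠ 0) :
    ¬ p ∣ q := by
  rintro ⟨c, rfl⟩
  apply hq
  rw [map_mul, hp, zero_mul]

lemma prime_sv (i : Fin 3) : Prime (sv i) := by
  refine prime_of_retraction _ (aeval (fun j => if j = i then X (i+1) else X j)) ?_ ?_ ?_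
  · intro h
    have := congrArg (eval (fun j => if j = i then (1:ℤ) else 0)) h
    fin_cases i <;> simp [sv] at this
  · fin_cases i <;> simp [sv]
  · intro j
    by_cases h : j = i
    · subst h; simp [sv]
    · simp [h]

lemma prime_sv_succ (i : Fin 3) : Prime (sv i - sv (i+1)) := by
  refine prime_of_retraction _
    (aeval (fun j => if j = i then 2 * X (i+1) - X (i+2) else X j)) ?_ ?_ ?_
  · intro h
    have := congrArg (eval (fun j => if j = i then (1:ℤ) else 0)) h
    fin_cases i <;> simp [sv] at this
  · fin_cases i <;> simp [sv] <;> ring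
  · intro j
    by_cases h : j = i
    · subst h
      have e : j + 1 + 1 = j + 2 := by rw [add_assoc]; rfl
      simp only [aeval_X, if_true, sv, e]
      exact ⟨1, by ring⟩
    · simp [h]

lemma prime_sv_sub (i j : Fin 3) (h : i ≠ j) : Prime (sv i - sv j) := by
  have : j = i + 1 ∨ i = j + 1 := by revert i j; decide
  rcases this with rfl | rfl
  · exact prime_sv_succ i
  · rw [← neg_sub]; exact (prime_sv_succ j).neg

lemma sv_sum : sv 0 + sv 1 + sv 2 = 0 := by
  have e : (2 : Fin 3) + 1 = 0 := rfl
  have e' : (1 : Fin 3) + 1 = 2 := rfl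
  simp only [sv, e, e', zero_add]; ring

lemma sv_sum_perm (v : Perm (Fin 3)) (i j k : Fin 3) (h1 : i ≠ j) (h2 : k ≠ i) (h3 : k ≠ j) :
    sv (v i) + sv (v j) + sv (v k) = 0 := by
  have h : ∑ m, sv (v m) = ∑ m, sv m := Equiv.sum_comp v sv
  rw [Fin.sum_univ_three, Fin.sum_univ_three, sv_sum] at h
  fin_cases i <;> fin_cases j <;> fin_cases k <;> simp at h1 h2 h3 ⊢ <;>
    linear_combination h

lemma prime_mul_dvd {p q u : R3} (hq : Prime q) (h : ¬ q ∣ p) (h1 : p ∣ u) (h2 : q ∣ u) :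
    p * q ∣ u := by
  obtain ⟨w, rfl⟩ := h1
  exact mul_dvd_mul_left p ((hq.dvd_or_dvd h2).resolve_left h)

/-- The type `A₂` interpolation. -/
lemma interp (g : Perm (Fin 3) → R3)
    (hg : ∀ (v : Perm (Fin 3)) (i j : Fin 3), i ≠ j →
      sv (v i) - sv (v j) ∣ g v - g (v * Equiv.swap i j)) :
    ∃ P : MvPolynomial (Fin 3) R3, ∀ v, g v = eval (fun i => sv (v i)) P := by
  have nd1 : ¬ (sv 2 - sv 0) ∣ (sv 1 - sv 0) :=
    not_dvd_of_eval ![1, 0, 2] (by simp [sv]) (by simp [sv])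
  have nd2 : ¬ (sv 2 - sv 1) ∣ (sv 2 - sv 0) :=
    not_dvd_of_eval ![0, 2, 1] (by simp [sv]) (by simp [sv])
  have nd3 : ¬ (sv 1 - sv 0) ∣ (sv 2 - sv 0) * (sv 2 - sv 1) :=
    not_dvd_of_eval ![0, 1, 2] (by simp [sv]) (by simp [sv])
  have p20 := prime_sv_sub 2 0 (by decide)
  have p21 := prime_sv_sub 2 1 (by decide)
  have p10 := prime_sv_sub 1 0 (by decide)
  have hval : ∀ (v w : Perm (Fin 3)) (i j a b : Fin 3), i ≠ j → v * Equiv.swap i j = w →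
      v i = a → v j = b → sv a - sv b ∣ g v - g w := by
    rintro v w i j a b hij rfl rfl rfl
    exact hg v i j hij
  -- the edges of the graph
  obtain ⟨r1, e1⟩ := hval (swap 0 1) 1 0 1 1 0 (by decide) (by decide) (by decide) (by decide)
  obtain ⟨r2, e2⟩ := hval (swap 1 2) 1 2 1 1 2 (by decide) (by decide) (by decide) (by decide)
  obtain ⟨x1, f1⟩ := hval (swap 0 1 * swap 1 2) (swap 1 2) 0 2 1 0
    (by decide) (by decide) (by decide) (by decide)
  obtain ⟨x2, f2⟩ := hval (swap 0 1 * swap 1 2) (swap 0 1) 1 2 2 0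
    (by decide) (by decide) (by decide) (by decide)
  obtain ⟨x3, f3⟩ := hval (swap 1 2 * swap 0 1) (swap 1 2) 0 1 2 0
    (by decide) (by decide) (by decide) (by decide)
  obtain ⟨x4, f4⟩ := hval (swap 1 2 * swap 0 1) (swap 0 1) 0 2 2 1
    (by decide) (by decide) (by decide) (by decide)
  obtain ⟨x5, f5⟩ := hval (swap 0 2) 1 0 2 2 0
    (by decide) (by decide) (by decide) (by decide)
  obtain ⟨x6, f6⟩ := hval (swap 0 2) (swap 0 1 * swap 1 2) 0 1 2 1
    (by decide) (by decide) (by decide) (by decide)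
  obtain ⟨x7, f7⟩ := hval (swap 0 2) (swap 1 2 * swap 0 1) 1 2 1 0
    (by decide) (by decide) (by decide) (by decide)
  set a := sv 0
  set b := sv 1
  set c := sv 2
  set r0 := g 1
  obtain ⟨r3, e3⟩ : (b - a) * (c - a) ∣
      g (swap 0 1 * swap 1 2) - (r0 + r1 * (b - a) + r2 * (a - c)) := by
    apply prime_mul_dvd p20 nd1
    · exact ⟨x1 + r2 - r1, by linear_combination f1 + e2⟩
    · exact ⟨x2 + r2, by linear_combination f2 + e1⟩
  obtain ⟨r4, e4⟩ : (c - a) * (c - b) ∣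
      g (swap 1 2 * swap 0 1) - (r0 + r1 * (c - a) + r2 * (b - c)) := by
    apply prime_mul_dvd p21 nd2
    · exact ⟨x3 - r1, by linear_combination f3 + e2⟩
    · exact ⟨x4 - r1 + r2, by linear_combination f4 + e1⟩
  obtain ⟨r5, e5⟩ : (c - a) * (c - b) * (b - a) ∣
      g (swap 0 2) - (r0 + r1 * (c - a) + r2 * (a - c) + r3 * ((c - a) * (b - a))
        + r4 * ((c - a) * (c - b))) := by
    apply prime_mul_dvd p10 nd3
    · apply prime_mul_dvd p21 nd2
      · exact ⟨x5 - r1 + r2 - r3 * (b - a) - r4 * (c - b), by linear_combination f5⟩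
      · exact ⟨x6 - r1 - r3 * 0 - r4 * (c - a), by linear_combination f6 + e3⟩
    · exact ⟨x7 + r2 - r3 * (c - a), by linear_combination f7 + e4⟩
  refine ⟨C r0 + C r1 * (X 0 - C a) + C r2 * (X 2 - C c) + C r3 * ((X 0 - C a) * (X 1 - C a))
    + C r4 * ((X 0 - C a) * (X 0 - C b))
    + C r5 * ((X 0 - C a) * (X 0 - C b) * (X 1 - C a)), ?_⟩
  intro v
  simp only [map_add, map_mul, map_sub, eval_C, eval_X]
  have hv : v = 1 ∨ v = swap 0 1 ∨ v = swap 1 2 ∨ v = swap 0 1 * swap 1 2 ∨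
      v = swap 1 2 * swap 0 1 ∨ v = swap 0 2 := by revert v; decide
  have red : ∀ (x y z : Fin 3), v 0 = x → v 1 = y → v 2 = z →
      g v = r0 + r1 * (sv x - a) + r2 * (sv z - c) + r3 * ((sv x - a) * (sv y - a))
        + r4 * ((sv x - a) * (sv x - b)) + r5 * ((sv x - a) * (sv x - b) * (sv y - a)) →
      g v = r0 + r1 * (sv (v 0) - a) + r2 * (sv (v 2) - c)
        + r3 * ((sv (v 0) - a) * (sv (v 1) - a))
        + r4 * ((sv (v 0) - a) * (sv (v 0) - b))
        + r5 * ((sv (v 0) - a) * (sv (v 0) - b) * (sv (v 1) - a)) := by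
    rintro x y z rfl rfl rfl h
    exact h
  rcases hv with rfl | rfl | rfl | rfl | rfl | rfl
  · exact red 0 1 2 (by decide) (by decide) (by decide) (by ring)
  · exact red 1 0 2 (by decide) (by decide) (by decide) (by linear_combination e1)
  · exact red 0 2 1 (by decide) (by decide) (by decide) (by linear_combination e2)
  · exact red 1 2 0 (by decide) (by decide) (by decide) (by linear_combination e3)
  · exact red 2 0 1 (by decide) (by decide) (by decide) (by linear_combination e4)
  · exact red 2 1 0 (by decide) (by decide) (by decide) (by linear_combination e5)

lemma tau_swap_cases (v₁ v₂ : Perm (Fin 3)) (i j m : Fin 3) (hij : i ≠ j)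
    (hv : v₁ = v₂ * Equiv.swap i j) :
    (m = i ∧ v₂ m = v₁ j) ∨ (m = j ∧ v₂ m = v₁ i) ∨ (m ≠ i ∧ m ≠ j ∧ v₂ m = v₁ m) := by
  subst hv
  by_cases h1 : m = i
  · subst h1; left; simp
  by_cases h2 : m = j
  · subst h2; right; left; simp
  · right; right; simp [h1, h2, swap_apply_of_ne_of_ne h1 h2]

lemma tauG_mem (m : Fin 3) : tauG m ∈ HTG2 := by
  intro v₁ v₂ ε₁ ε₂ i j hij hv
  have hc := tau_swap_cases v₁ v₂ i j m hij hv
  constructor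
  · rintro rfl
    rcases hc with ⟨rfl, h⟩ | ⟨rfl, h⟩ | ⟨h1, h2, h⟩ <;> cases ε₁ <;> simp only [tauG, h]
    · exact ⟨-1, by simp; ring⟩
    · exact ⟨1, by simp⟩
    · exact ⟨1, by simp; ring⟩
    · exact ⟨-1, by simp⟩
    · simp
    · simp
  · intro hε k hki hkj
    have hs := sv_sum_perm v₁ i j k hij hki hkj
    have hmk : m ≠ i → m ≠ j → m = k := by
      clear hs hv hc hε
      revert i j k m; decide
    have hε' : ε₂ = !ε₁ := by revert hε; revert ε₁ ε₂; decide
    subst hε'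
    rcases hc with ⟨rfl, h⟩ | ⟨rfl, h⟩ | ⟨h1, h2, h⟩ <;> cases ε₁ <;> simp only [tauG, h]
    · exact ⟨1, by simp; linear_combination -hs⟩
    · exact ⟨-1, by simp; linear_combination hs⟩
    · exact ⟨1, by simp; linear_combination -hs⟩
    · exact ⟨-1, by simp; linear_combination hs⟩
    · rw [hmk h1 h2]; exact ⟨-2, by simp; ring⟩
    · rw [hmk h1 h2]; exact ⟨2, by simp; ring⟩

lemma tG_mem (m : Fin 3) : tG m ∈ HTG2 := by
  intro v₁ v₂ ε₁ ε₂ i j hij hv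
  simp [tG]

lemma sv_dvd_prod (m : Fin 3) : sv m ∣ sv 0 * sv 1 * sv 2 := by
  fin_cases m
  · exact ⟨sv 1 * sv 2, by simp; ring⟩
  · exact ⟨sv 0 * sv 2, by simp; ring⟩
  · exact ⟨sv 0 * sv 1, by simp; ring⟩

lemma fG_mem : fG ∈ HTG2 := by
  intro v₁ v₂ ε₁ ε₂ i j hij hv
  constructor
  · rintro rfl
    simp [fG]
  · intro hε k _ _
    have := sv_dvd_prod (v₁ k)
    cases ε₁ <;> cases ε₂ <;> simp [fG] at hε ⊢ <;> exact this

lemma prod_dvd {u : R3} (h : ∀ i, sv i ∣ u) : sv 0 * sv 1 * sv 2 ∣ u := by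
  apply prime_mul_dvd (prime_sv 2)
  · exact not_dvd_of_eval ![0, 1, 0] (by simp [sv]) (by simp [sv])
  · apply prime_mul_dvd (prime_sv 1) _ (h 0) (h 1)
    exact not_dvd_of_eval ![1, 0, 0] (by simp [sv]) (by simp [sv])
  · exact h 2

lemma not_dvd_prod (i j : Fin 3) (h : i ≠ j) : ¬ (sv i - sv j) ∣ sv 0 * sv 1 * sv 2 := by
  have hp := prime_sv_sub i j h
  intro hd
  have n : ∀ m, ¬ (sv i - sv j) ∣ sv m := by
    intro m
    fin_cases i <;> fin_cases j <;> simp at h ⊢ <;>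
      first
      | (refine not_dvd_of_eval ![0, 1, 2] ?_ ?_ <;> [skip; fin_cases m] <;> simp [sv] <;> done)
      | (refine not_dvd_of_eval ![1, 0, 2] ?_ ?_ <;> [skip; fin_cases m] <;> simp [sv] <;> done)
      | (refine not_dvd_of_eval ![0, 2, 1] ?_ ?_ <;> [skip; fin_cases m] <;> simp [sv] <;> done)
  rcases hp.dvd_or_dvd hd with hd | hd
  · rcases hp.dvd_or_dvd hd with hd | hd
    · exact n 0 hd
    · exact n 1 hd
  · exact n 2 hd

/-- `H*_T(𝒢₂)` is generated as a ring by `τ₁, τ₂, τ₃, t₁, t₂, t₃` and `f`. -/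
theorem HTG2_generated_by :
    Subring.closure {tauG 0, tauG 1, tauG 2, tG 0, tG 1, tG 2, fG} = HTG2 := by
  apply le_antisymm
  · rw [Subring.closure_le]
    rintro x (rfl | rfl | rfl | rfl | rfl | rfl | rfl)
    · exact tauG_mem 0
    · exact tauG_mem 1
    · exact tauG_mem 2
    · exact tG_mem 0
    · exact tG_mem 1
    · exact tG_mem 2
    · exact fG_mem
  · intro h hh
    have hh : gkm h := hh
    set S := Subring.closure {tauG 0, tauG 1, tauG 2, tG 0, tG 1, tG 2, fG} with hS
    have mt : ∀ i, tauG i ∈ S := by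
      intro i; apply Subring.subset_closure; fin_cases i <;> simp
    have mx : ∀ i, tG i ∈ S := by
      intro i; apply Subring.subset_closure; fin_cases i <;> simp
    have mf : fG ∈ S := by
      apply Subring.subset_closure; simp
    have mc : ∀ r : R3, (fun _ => r : V2 → R3) ∈ S := by
      intro r
      induction r using MvPolynomial.induction_on with
      | C a =>
        have : (fun _ => C a : V2 → R3) = ((a : ℤ) : V2 → R3) := by
          funext w; simp
        rw [this]; exact intCast_mem S a
      | add a b ha hb => exact S.add_mem ha hb
      | mul_X a i ha => exact S.mul_mem ha (mx i)
    have mp : ∀ (y : Fin 3 → V2 → R3), (∀ i, y i ∈ S) → ∀ P : MvPolynomial (Fin 3) R3,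
        (fun w => eval (fun i => y i w) P) ∈ S := by
      intro y hy P
      induction P using MvPolynomial.induction_on with
      | C a => simpa using mc a
      | add a b ha hb =>
        simp only [map_add]; exact S.add_mem ha hb
      | mul_X a i ha =>
        simp only [map_mul, eval_X]; exact S.mul_mem ha (hy i)
    obtain ⟨P, hP⟩ := interp (fun v => h (v, true)) (fun v i j hij =>
      (hh v (v * swap i j) true true i j hij (by simp [mul_assoc])).1 rfl)
    have hPm := mp tauG mt P
    set hp : V2 → R3 := fun w => eval (fun i => tauG i w) P with hhp
    have hle : S ≤ HTG2 := by
      rw [hS, Subring.closure_le]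
      rintro x (rfl | rfl | rfl | rfl | rfl | rfl | rfl)
      · exact tauG_mem 0
      · exact tauG_mem 1
      · exact tauG_mem 2
      · exact tG_mem 0
      · exact tG_mem 1
      · exact tG_mem 2
      · exact fG_mem
    have hd : gkm (h - hp) := HTG2.sub_mem (show h ∈ HTG2 from hh) (hle hPm)
    have hd0 : ∀ v, (h - hp) (v, true) = 0 := by
      intro v
      have := hP v
      simp only [Pi.sub_apply, hhp, tauG, if_true]
      rw [sub_eq_zero]; exact this
    have hdiv : ∀ v, sv 0 * sv 1 * sv 2 ∣ (h - hp) (v, false) := by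
      intro v
      apply prod_dvd
      intro m
      obtain ⟨k, rfl⟩ := v.surjective m
      have hex : ∀ k : Fin 3, ∃ i j : Fin 3, i ≠ j ∧ k ≠ i ∧ k ≠ j := by decide
      obtain ⟨i, j, hij, hki, hkj⟩ := hex k
      have := (hd v (v * swap i j) false true i j hij (by simp [mul_assoc])).2 (by simp) k hki hkj
      rwa [hd0, sub_zero] at this
    choose g hg using hdiv
    obtain ⟨Q, hQ⟩ := interp g (by
      intro v i j hij
      have := (hd v (v * swap i j) false false i j hij (by simp [mul_assoc])).1 rfl
      rw [hg, hg, ← mul_sub] at this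
      exact ((prime_sv_sub _ _ (v.injective.ne hij)).dvd_or_dvd this).resolve_left
        (not_dvd_prod _ _ (v.injective.ne hij)))
    have hQm := mp (fun i => - tauG i) (fun i => S.neg_mem (mt i)) Q
    have key : h = hp + ((fun _ => sv 0 * sv 1 * sv 2) - fG) *
        (fun w => eval (fun i => (- tauG i) w) Q) := by
      funext ⟨v, ε⟩
      cases ε
      · have h1 := hg v
        have h2 := hQ v
        rw [Pi.sub_apply] at h1
        simp only [Pi.add_apply, Pi.mul_apply, Pi.sub_apply, Pi.neg_apply, fG, tauG]
        simp only [Bool.false_eq_true, if_false, neg_neg, sub_zero]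
        rw [← h2]
        linear_combination h1
      · have h1 := hd0 v
        rw [Pi.sub_apply] at h1
        simp only [Pi.add_apply, Pi.mul_apply, Pi.sub_apply, fG, if_true]
        linear_combination h1
    rw [key]
    exact S.add_mem hPm (S.mul_mem (S.sub_mem (mc _) mf) hQm)
end

section
/- Let φ : ℤ[x₁,x₂,x₃,y₁,y₂,y₃] → ∏_{v ∈ S₃} R be the ring homomorphism with φ(xᵢ) = τᵢ and φ(yᵢ) = tᵢ (the constant function with value tᵢ). Then the image of φ equals H*_T(𝒜₃) and the kernel of φ equals the ideal J generated by eᵢ(x₁,x₂,x₃) − eᵢ(y₁,y₂,y₃) for i = 1,2,3, where eᵢ denotes the i-th elementary symmetric polynomial; consequently H*_T(𝒜₃) ≅ ℤ[x₁,x₂,x₃,y₁,y₂,y₃]/J as rings. -/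
open MvPolynomial Equiv

/-- The GKM condition for the labeled graph `𝒜₃` of the flag manifold of type `A₂`:
for every edge with endpoints `v₁, v₂` and label `t_{v₁(i)} − t_{v₁(j)}`, the
difference `h v₁ - h v₂` is divisible by the label. -/
def gkmA (h : Perm (Fin 3) → R3) : Prop :=
  ∀ (v₁ v₂ : Perm (Fin 3)) (i j : Fin 3), i ≠ j → v₁ = v₂ * Equiv.swap i j →
    (X (v₁ i) - X (v₁ j) : R3) ∣ h v₁ - h v₂

/-- `τᵢ(v) = t_{v(i)}`. -/
noncomputable def tauA (i : Fin 3) : Perm (Fin 3) → R3 := fun v => X (v i)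

/-- The graph cohomology ring `H*_T(𝒜₃)` as a subring of `∏_{v ∈ S₃} R`. -/
noncomputable def HTA3 : Subring (Perm (Fin 3) → R3) where
  carrier := {h | gkmA h}
  zero_mem' := by intro v₁ v₂ i j _ _; simp
  one_mem' := by intro v₁ v₂ i j _ _; simp
  add_mem' := by
    intro a b ha hb v₁ v₂ i j hij hv
    have key : (a + b) v₁ - (a + b) v₂ = (a v₁ - a v₂) + (b v₁ - b v₂) := by
      simp only [Pi.add_apply]; ring
    rw [key]; exact dvd_add (ha v₁ v₂ i j hij hv) (hb v₁ v₂ i j hij hv)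
  neg_mem' := by
    intro a ha v₁ v₂ i j hij hv
    have key : (-a) v₁ - (-a) v₂ = -(a v₁ - a v₂) := by
      simp only [Pi.neg_apply]; ring
    rw [key]; exact (dvd_neg).mpr (ha v₁ v₂ i j hij hv)
  mul_mem' := by
    intro a b ha hb v₁ v₂ i j hij hv
    have key : (a * b) v₁ - (a * b) v₂
        = a v₁ * (b v₁ - b v₂) + (a v₁ - a v₂) * b v₂ := by
      simp only [Pi.mul_apply]; ring
    rw [key]
    exact dvd_add ((hb v₁ v₂ i j hij hv).mul_left _) ((ha v₁ v₂ i j hij hv).mul_right _)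

/-- The ring homomorphism `φ : ℤ[x₁,x₂,x₃,y₁,y₂,y₃] → ∏_{v ∈ S₃} R` with
`φ(xᵢ) = τᵢ` and `φ(yᵢ) = tᵢ` (the constant function with value `tᵢ`), where
`x₁,x₂,x₃,y₁,y₂,y₃` are the variables `X 0, …, X 5`. -/
noncomputable def φA : MvPolynomial (Fin 6) ℤ →+* (Perm (Fin 3) → R3) :=
  eval₂Hom (Int.castRingHom _)
    ![tauA 0, tauA 1, tauA 2, fun _ => X 0, fun _ => X 1, fun _ => X 2]

/-- The ideal `J = (e₁(x) − e₁(y), e₂(x) − e₂(y), e₃(x) − e₃(y))`. -/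
noncomputable def Ja : Ideal (MvPolynomial (Fin 6) ℤ) :=
  Ideal.span {(X 0 + X 1 + X 2) - (X 3 + X 4 + X 5),
    (X 0 * X 1 + X 0 * X 2 + X 1 * X 2) - (X 3 * X 4 + X 3 * X 5 + X 4 * X 5),
    X 0 * X 1 * X 2 - X 3 * X 4 * X 5}

/-- Cancelling a coprime factor in front of a linear form `X i - X j`. -/
lemma lin_dvd_cancel (i j k l : Fin 3)
    (hne : (if k = i then j else k) ≠ (if l = i then j else l)) (q : R3)
    (h : (X i - X j : R3) ∣ (X k - X l) * q) : (X i - X j : R3) ∣ q := by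
  let f : Fin 3 → R3 := fun m => X (if m = i then j else m)
  have hmod : ∀ p : R3, (X i - X j : R3) ∣ p - aeval f p := by
    intro p
    induction p using MvPolynomial.induction_on with
    | C a => simp
    | add p q hp hq =>
      have e : p + q - aeval f (p + q) = (p - aeval f p) + (q - aeval f q) := by
        rw [map_add]; ring
      rw [e]; exact dvd_add hp hq
    | mul_X p n hp =>
      have e : p * X n - aeval f (p * X n)
          = (p - aeval f p) * X n + aeval f p * (X n - f n) := by
        rw [map_mul, aeval_X]; ring
      rw [e]
      refine dvd_add (hp.mul_right _) (Dvd.dvd.mul_left ?_ _)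
      by_cases hn : n = i
      · simp [f, hn]
      · simp [f, hn]
  obtain ⟨s, hs⟩ := h
  have h0 : aeval f ((X k - X l) * q) = 0 := by
    rw [hs, map_mul, map_sub, aeval_X, aeval_X]
    simp [f]
  rw [map_mul, map_sub, aeval_X, aeval_X] at h0
  rcases mul_eq_zero.mp h0 with h1 | h1
  · exact absurd (X_injective (sub_eq_zero.mp h1)) hne
  · have := hmod q
    rwa [h1, sub_zero] at this

/-- The inclusion of the coefficient ring. -/
noncomputable def rhoA : R3 →+* MvPolynomial (Fin 6) ℤ :=
  eval₂Hom (Int.castRingHom _) ![X 3, X 4, X 5]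

lemma rhoA_X0 : rhoA (X 0) = X 3 := by simp [rhoA]
lemma rhoA_X1 : rhoA (X 1) = X 4 := by simp [rhoA]
lemma rhoA_X2 : rhoA (X 2) = X 5 := by simp [rhoA]

/-- Combination of the interpolation basis. -/
noncomputable def combA (c0 c1 c2 c3 c4 c5 : R3) : MvPolynomial (Fin 6) ℤ :=
  rhoA c0 + rhoA c1 * (X 1 - X 4) + rhoA c2 * (X 0 - X 3)
    + rhoA c3 * ((X 0 - X 3) * (X 1 - X 3))
    + rhoA c4 * ((X 0 - X 3) * (X 0 - X 4))
    + rhoA c5 * ((X 0 - X 3) * (X 0 - X 4) * (X 1 - X 3))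

lemma phi_X0 (v : Perm (Fin 3)) : φA (X 0) v = X (v 0) := by simp [φA, tauA]
lemma phi_X1 (v : Perm (Fin 3)) : φA (X 1) v = X (v 1) := by simp [φA, tauA]
lemma phi_X2 (v : Perm (Fin 3)) : φA (X 2) v = X (v 2) := by simp [φA, tauA]
lemma phi_X3 (v : Perm (Fin 3)) : φA (X 3) v = X 0 := by simp [φA]
lemma phi_X4 (v : Perm (Fin 3)) : φA (X 4) v = X 1 := by simp [φA]
lemma phi_X5 (v : Perm (Fin 3)) : φA (X 5) v = X 2 := by simp [φA]

lemma phi_rho (c : R3) (v : Perm (Fin 3)) : φA (rhoA c) v = c := by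
  have : (((Pi.evalRingHom (fun _ : Perm (Fin 3) => R3) v).comp φA).comp rhoA)
      = RingHom.id R3 := by
    apply MvPolynomial.ringHom_ext
    · intro r; simp
    · intro i
      fin_cases i
      · simp [rhoA_X0, phi_X3]
      · simp [rhoA_X1, phi_X4]
      · simp [rhoA_X2, phi_X5]
  exact congrArg (fun g => g c) this

lemma phi_comb (c0 c1 c2 c3 c4 c5 : R3) (v : Perm (Fin 3)) :
    φA (combA c0 c1 c2 c3 c4 c5) v =
    c0 + c1 * (X (v 1) - X 1) + c2 * (X (v 0) - X 0)
    + c3 * ((X (v 0) - X 0) * (X (v 1) - X 0))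
    + c4 * ((X (v 0) - X 0) * (X (v 0) - X 1))
    + c5 * ((X (v 0) - X 0) * (X (v 0) - X 1) * (X (v 1) - X 0)) := by
  simp only [combA, map_add, map_mul, map_sub, Pi.add_apply, Pi.mul_apply, Pi.sub_apply,
    phi_rho, phi_X0, phi_X1, phi_X3, phi_X4]

lemma g1_mem : ((X 0 + X 1 + X 2) - (X 3 + X 4 + X 5) : MvPolynomial (Fin 6) ℤ) ∈ Ja :=
  Ideal.subset_span (by simp)
lemma g2_mem : ((X 0 * X 1 + X 0 * X 2 + X 1 * X 2) - (X 3 * X 4 + X 3 * X 5 + X 4 * X 5)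
    : MvPolynomial (Fin 6) ℤ) ∈ Ja :=
  Ideal.subset_span (by simp)
lemma g3_mem : (X 0 * X 1 * X 2 - X 3 * X 4 * X 5 : MvPolynomial (Fin 6) ℤ) ∈ Ja :=
  Ideal.subset_span (by simp)

lemma cubic_mem : ((X 0 - X 3) * (X 0 - X 4) * (X 0 - X 5) : MvPolynomial (Fin 6) ℤ) ∈ Ja := by
  have := Ja.add_mem (Ja.sub_mem (Ja.mul_mem_left (X 0 ^ 2) g1_mem)
    (Ja.mul_mem_left (X 0) g2_mem)) g3_mem
  convert this using 1
  ring

lemma quad_mem : (X 0 ^ 2 + X 0 * X 1 + X 1 ^ 2 - (X 3 + X 4 + X 5) * (X 0 + X 1)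
    + (X 3 * X 4 + X 3 * X 5 + X 4 * X 5) : MvPolynomial (Fin 6) ℤ) ∈ Ja := by
  have := Ja.sub_mem (Ja.mul_mem_left (X 0 + X 1) g1_mem) g2_mem
  convert this using 1
  ring

/-- Having a normal form modulo `Ja`. -/
def NF (p : MvPolynomial (Fin 6) ℤ) : Prop :=
  ∃ c0 c1 c2 c3 c4 c5 : R3, p - combA c0 c1 c2 c3 c4 c5 ∈ Ja

lemma NF_add {p q : MvPolynomial (Fin 6) ℤ} (hp : NF p) (hq : NF q) : NF (p + q) := by
  obtain ⟨c0, c1, c2, c3, c4, c5, h⟩ := hp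
  obtain ⟨d0, d1, d2, d3, d4, d5, h'⟩ := hq
  refine ⟨c0 + d0, c1 + d1, c2 + d2, c3 + d3, c4 + d4, c5 + d5, ?_⟩
  convert Ja.add_mem h h' using 1
  simp only [combA, map_add]; ring

lemma NF_rho_mul (a : R3) {p : MvPolynomial (Fin 6) ℤ} (hp : NF p) : NF (rhoA a * p) := by
  obtain ⟨c0, c1, c2, c3, c4, c5, h⟩ := hp
  refine ⟨a * c0, a * c1, a * c2, a * c3, a * c4, a * c5, ?_⟩
  convert Ja.mul_mem_left (rhoA a) h using 1
  simp only [combA, map_mul]; ring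

lemma NF_X0_mul {p : MvPolynomial (Fin 6) ℤ} (hp : NF p) : NF (X 0 * p) := by
  obtain ⟨c0, c1, c2, c3, c4, c5, h⟩ := hp
  refine ⟨X 0 * c0, X 0 * c1, c0 + (X 0 - X 1) * c1 + X 1 * c2, c1 + X 1 * c3,
    c2 + X 2 * c4, c3 + X 2 * c5, ?_⟩
  convert Ja.add_mem (Ja.mul_mem_left (X 0) h)
    (Ja.mul_mem_left (rhoA c4 + rhoA c5 * (X 1 - X 3)) cubic_mem) using 1
  simp only [combA, map_mul, map_add, map_sub, rhoA_X0, rhoA_X1, rhoA_X2]; ring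

lemma NF_X1_mul {p : MvPolynomial (Fin 6) ℤ} (hp : NF p) : NF (X 1 * p) := by
  obtain ⟨c0, c1, c2, c3, c4, c5, h⟩ := hp
  refine ⟨X 1 * c0, c0 + X 2 * c1, (X 2 - X 0) * c1 + X 0 * c2, -c1 + c2 + X 2 * c3,
    -c1 + X 0 * c4, -c3 + c4 + X 1 * c5, ?_⟩
  convert Ja.add_mem (Ja.add_mem (Ja.mul_mem_left (X 1) h)
    (Ja.mul_mem_left (rhoA c1 + rhoA c3 * (X 0 - X 3)
      + rhoA c5 * ((X 0 - X 3) * (X 0 - X 4))) quad_mem))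
    (Ja.mul_mem_left (-rhoA c3 - rhoA c5 * (X 0 + X 1 - X 3 - X 4)) cubic_mem) using 1
  simp only [combA, map_mul, map_add, map_sub, map_neg, rhoA_X0, rhoA_X1, rhoA_X2]; ring

lemma NF_of_sub {p q : MvPolynomial (Fin 6) ℤ} (h : p - q ∈ Ja) (hq : NF q) : NF p := by
  obtain ⟨c0, c1, c2, c3, c4, c5, h'⟩ := hq
  refine ⟨c0, c1, c2, c3, c4, c5, ?_⟩
  convert Ja.add_mem h h' using 1
  ring

lemma NF_all (p : MvPolynomial (Fin 6) ℤ) : NF p := by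
  induction p using MvPolynomial.induction_on with
  | C a =>
    refine ⟨C a, 0, 0, 0, 0, 0, ?_⟩
    have : (C a : MvPolynomial (Fin 6) ℤ) - combA (C a) 0 0 0 0 0 = 0 := by
      simp [combA, rhoA]
    rw [this]; exact Ja.zero_mem
  | add p q hp hq => exact NF_add hp hq
  | mul_X p n hp =>
    rw [mul_comm]
    fin_cases n
    · exact NF_X0_mul hp
    · exact NF_X1_mul hp
    · refine NF_of_sub (q := rhoA (X 0 + X 1 + X 2) * p + (rhoA (-1) * (X 0 * p)
        + rhoA (-1) * (X 1 * p))) ?_ (NF_add (NF_rho_mul _ hp)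
        (NF_add (NF_rho_mul _ (NF_X0_mul hp)) (NF_rho_mul _ (NF_X1_mul hp))))
      convert Ja.mul_mem_left p g1_mem using 1
      simp only [map_add, map_neg, map_one, rhoA_X0, rhoA_X1, rhoA_X2]
      change X 2 * p - _ = _
      ring
    · have := NF_rho_mul (X 0) hp; rwa [rhoA_X0] at this
    · have := NF_rho_mul (X 1) hp; rwa [rhoA_X1] at this
    · have := NF_rho_mul (X 2) hp; rwa [rhoA_X2] at this

lemma phi_mem (p : MvPolynomial (Fin 6) ℤ) : φA p ∈ HTA3 := by
  induction p using MvPolynomial.induction_on with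
  | C a =>
    intro v₁ v₂ i j _ _
    simp [φA]
  | add p q hp hq => rw [map_add]; exact HTA3.add_mem hp hq
  | mul_X p n hp =>
    rw [map_mul]
    refine HTA3.mul_mem hp ?_
    have key : ∀ m : Fin 3, tauA m ∈ HTA3 := by
      intro m v₁ v₂ i j hij hv
      have hv' : v₂ = v₁ * Equiv.swap i j := by
        rw [hv, mul_assoc, Equiv.swap_mul_self, mul_one]
      simp only [tauA, hv', Perm.mul_apply]
      by_cases hi : m = i
      · subst hi; simp
      · by_cases hj : m = j
        · subst hj
          rw [Equiv.swap_apply_right]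
          exact ⟨-1, by ring⟩
        · rw [Equiv.swap_apply_of_ne_of_ne hi hj]; simp
    have key' : ∀ r : R3, (fun _ => r : Perm (Fin 3) → R3) ∈ HTA3 := by
      intro r v₁ v₂ i j hij hv
      simp
    fin_cases n
    · simpa [φA] using key 0
    · simpa [φA] using key 1
    · simpa [φA] using key 2
    · simpa [φA] using key' (X 0)
    · simpa [φA] using key' (X 1)
    · simpa [φA] using key' (X 2)

lemma perm_cases (v : Perm (Fin 3)) : v = 1 ∨ v = swap 1 2 ∨ v = swap 0 1 ∨
    v = swap 0 1 * swap 1 2 ∨ v = swap 1 2 * swap 0 1 ∨ v = swap 0 2 := by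
  revert v; decide

lemma X_sub_ne (i j : Fin 3) (h : i ≠ j) : (X i - X j : R3) ≠ 0 :=
  fun e => h (X_injective (sub_eq_zero.mp e))

lemma v231_0 : (swap 0 1 * swap 1 2 : Perm (Fin 3)) 0 = 1 := by decide
lemma v231_1 : (swap 0 1 * swap 1 2 : Perm (Fin 3)) 1 = 2 := by decide
lemma v312_0 : (swap 1 2 * swap 0 1 : Perm (Fin 3)) 0 = 2 := by decide
lemma v312_1 : (swap 1 2 * swap 0 1 : Perm (Fin 3)) 1 = 0 := by decide
lemma v132_0 : (swap 1 2 : Perm (Fin 3)) 0 = 0 := by decide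
lemma v132_1 : (swap 1 2 : Perm (Fin 3)) 1 = 2 := by decide
lemma v213_0 : (swap 0 1 : Perm (Fin 3)) 0 = 1 := by decide
lemma v213_1 : (swap 0 1 : Perm (Fin 3)) 1 = 0 := by decide
lemma v321_0 : (swap 0 2 : Perm (Fin 3)) 0 = 2 := by decide
lemma v321_1 : (swap 0 2 : Perm (Fin 3)) 1 = 1 := by decide

lemma exists_comb (h : Perm (Fin 3) → R3) (hh : gkmA h) :
    ∃ c0 c1 c2 c3 c4 c5 : R3, φA (combA c0 c1 c2 c3 c4 c5) = h := by
  have d : ∀ (v₁ v₂ : Perm (Fin 3)) (i j a b : Fin 3), i ≠ j → v₁ = v₂ * Equiv.swap i j →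
      v₁ i = a → v₁ j = b → ∃ q, h v₁ - h v₂ = (X a - X b) * q := by
    intro v₁ v₂ i j a b hij hv ha hb
    have := hh v₁ v₂ i j hij hv
    rw [ha, hb] at this
    exact this
  obtain ⟨c1, e1⟩ := d (swap 1 2) 1 1 2 2 1 (by decide) (by decide) (by decide) (by decide)
  obtain ⟨q2, e2⟩ := d (swap 0 1) 1 0 1 1 0 (by decide) (by decide) (by decide) (by decide)
  obtain ⟨c2, hc2⟩ : ∃ c2, c2 = q2 + c1 := ⟨_, rfl⟩
  -- the vertex 231
  obtain ⟨q3, e3⟩ := d (swap 0 1 * swap 1 2) (swap 1 2) 0 2 1 0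
    (by decide) (by decide) (by decide) (by decide)
  obtain ⟨q3', e3'⟩ := d (swap 0 1 * swap 1 2) (swap 0 1) 1 2 2 0
    (by decide) (by decide) (by decide) (by decide)
  obtain ⟨c3, hc3⟩ : (X 2 - X 0 : R3) ∣ q3 - c2 := by
    apply lin_dvd_cancel 2 0 1 0 (by decide)
    refine ⟨q3' - c1, ?_⟩
    linear_combination e3' - e3 - e1 + e2 - (X 1 - X 0) * hc2
  -- the vertex 312
  obtain ⟨q4, e4⟩ := d (swap 1 2 * swap 0 1) (swap 1 2) 0 1 2 0
    (by decide) (by decide) (by decide) (by decide)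
  obtain ⟨q4', e4'⟩ := d (swap 1 2 * swap 0 1) (swap 0 1) 0 2 2 1
    (by decide) (by decide) (by decide) (by decide)
  obtain ⟨c4, hc4⟩ : (X 2 - X 1 : R3) ∣ q4 + c1 - c2 := by
    apply lin_dvd_cancel 2 1 2 0 (by decide)
    refine ⟨q4' - c2, ?_⟩
    linear_combination e4' - e4 - e1 + e2 - (X 1 - X 0) * hc2
  -- the vertex 321
  obtain ⟨q5, e5⟩ := d (swap 0 2) 1 0 2 2 0
    (by decide) (by decide) (by decide) (by decide)
  obtain ⟨q5', e5'⟩ := d (swap 0 2) (swap 1 2 * swap 0 1) 1 2 1 0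
    (by decide) (by decide) (by decide) (by decide)
  obtain ⟨q5'', e5''⟩ := d (swap 0 2) (swap 0 1 * swap 1 2) 0 1 2 1
    (by decide) (by decide) (by decide) (by decide)
  have f3 : h (swap 0 1 * swap 1 2) = h 1 + c1 * (X 2 - X 1) + c2 * (X 1 - X 0)
      + c3 * ((X 1 - X 0) * (X 2 - X 0)) := by
    linear_combination e3 + e1 + (X 1 - X 0) * hc3
  have f4 : h (swap 1 2 * swap 0 1) = h 1 + c1 * (X 0 - X 1) + c2 * (X 2 - X 0)
      + c4 * ((X 2 - X 0) * (X 2 - X 1)) := by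
    linear_combination e4 + e1 + (X 2 - X 0) * hc4
  obtain ⟨r, hr⟩ : (X 1 - X 0 : R3) ∣ q5 - c2 - c3 * (X 1 - X 0) - c4 * (X 2 - X 1) := by
    apply lin_dvd_cancel 1 0 2 0 (by decide)
    refine ⟨q5' - c1 - c3 * (X 2 - X 0), ?_⟩
    linear_combination e5' - e5 + f4
  obtain ⟨c5, hc5⟩ : (X 2 - X 1 : R3) ∣ r := by
    apply lin_dvd_cancel 2 1 1 0 (by decide)
    apply lin_dvd_cancel 2 1 2 0 (by decide)
    refine ⟨q5'' + c1 - c2 - c4 * (X 2 - X 0), ?_⟩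
    linear_combination e5'' - e5 + f3 - (X 2 - X 0) * hr
  refine ⟨h 1, c1, c2, c3, c4, c5, ?_⟩
  funext v
  rw [phi_comb]
  rcases perm_cases v with rfl | rfl | rfl | rfl | rfl | rfl
  · simp only [Perm.one_apply]; ring
  · rw [v132_0, v132_1]; linear_combination -e1
  · rw [v213_0, v213_1]; linear_combination -e2 + (X 1 - X 0) * hc2
  · rw [v231_0, v231_1]; linear_combination -f3
  · rw [v312_0, v312_1]; linear_combination -f4
  · rw [v321_0, v321_1]
    linear_combination -e5 - (X 2 - X 0) * hr - (X 2 - X 0) * (X 1 - X 0) * hc5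

lemma comb_inj (c0 c1 c2 c3 c4 c5 : R3) (h : φA (combA c0 c1 c2 c3 c4 c5) = 0) :
    combA c0 c1 c2 c3 c4 c5 = 0 := by
  have e : ∀ v, _ := fun v => (phi_comb c0 c1 c2 c3 c4 c5 v).symm.trans (congrFun h v)
  have n10 := X_sub_ne 1 0 (by decide)
  have n20 := X_sub_ne 2 0 (by decide)
  have n21 := X_sub_ne 2 1 (by decide)
  have h0 := e 1
  have h1 := e (swap 1 2)
  have h2 := e (swap 0 1)
  have h3 := e (swap 0 1 * swap 1 2)
  have h4 := e (swap 1 2 * swap 0 1)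
  have h5 := e (swap 0 2)
  rw [v132_0, v132_1] at h1
  rw [v213_0, v213_1] at h2
  rw [v231_0, v231_1] at h3
  rw [v312_0, v312_1] at h4
  rw [v321_0, v321_1] at h5
  simp only [Perm.one_apply, Pi.zero_apply, sub_self, mul_zero, zero_mul, add_zero] at h0 h1 h2 h3 h4 h5
  subst h0
  have k1 : c1 = 0 := by simpa [n21] using h1
  subst k1
  have k2 : c2 = 0 := by simpa [n10] using h2
  subst k2
  have k3 : c3 = 0 := by simpa [n10, n20] using h3
  subst k3
  have k4 : c4 = 0 := by simpa [n21, n20] using h4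
  subst k4
  have k5 : c5 = 0 := by simpa [n21, n20, n10] using h5
  subst k5
  simp [combA]

lemma Ja_le_ker : Ja ≤ RingHom.ker φA := by
  unfold Ja
  rw [Ideal.span_le]
  have key : ∀ p : MvPolynomial (Fin 6) ℤ, (∀ v, φA p v = 0) → p ∈ RingHom.ker φA :=
    fun p hp => (RingHom.mem_ker).mpr (funext hp)
  have a231 : (swap 0 1 * swap 1 2 : Perm (Fin 3)) 2 = 0 := by decide
  have a312 : (swap 1 2 * swap 0 1 : Perm (Fin 3)) 2 = 1 := by decide
  have a132 : (swap 1 2 : Perm (Fin 3)) 2 = 1 := by decide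
  have a213 : (swap 0 1 : Perm (Fin 3)) 2 = 2 := by decide
  have a321 : (swap 0 2 : Perm (Fin 3)) 2 = 0 := by decide
  rintro p (rfl | rfl | rfl) <;> refine key _ fun v => ?_ <;>
    simp only [map_add, map_mul, map_sub, Pi.add_apply, Pi.mul_apply, Pi.sub_apply,
      phi_X0, phi_X1, phi_X2, phi_X3, phi_X4, phi_X5] <;>
    rcases perm_cases v with rfl | rfl | rfl | rfl | rfl | rfl <;>
    simp only [v132_0, v132_1, a132, v213_0, v213_1, a213, v231_0, v231_1, a231,
      v312_0, v312_1, a312, v321_0, v321_1, a321, Perm.one_apply] <;> ring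

theorem image_eq_HTA3_and_ker_eq_J :
    Set.range ⇑φA = (HTA3 : Set (Perm (Fin 3) → R3)) ∧ RingHom.ker φA = Ja ∧
      Nonempty ((MvPolynomial (Fin 6) ℤ ⧸ Ja) ≃+* HTA3) := by
  have hrange : Set.range ⇑φA = (HTA3 : Set (Perm (Fin 3) → R3)) := by
    apply Set.Subset.antisymm
    · rintro _ ⟨p, rfl⟩
      exact phi_mem p
    · intro h hh
      obtain ⟨c0, c1, c2, c3, c4, c5, e⟩ := exists_comb h hh
      exact ⟨_, e⟩
  have hker : RingHom.ker φA = Ja := by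
    apply le_antisymm _ Ja_le_ker
    intro p hp
    obtain ⟨c0, c1, c2, c3, c4, c5, h⟩ := NF_all p
    have h1 := (RingHom.mem_ker).mp (Ja_le_ker h)
    rw [map_sub, (RingHom.mem_ker).mp hp, zero_sub, neg_eq_zero] at h1
    rwa [comb_inj _ _ _ _ _ _ h1, sub_zero] at h
  refine ⟨hrange, hker, ?_⟩
  have hr : φA.range = HTA3 := SetLike.coe_injective (by rw [RingHom.coe_range, hrange])
  exact ⟨((Ideal.quotEquivOfEq hker.symm).trans
    (RingHom.quotientKerEquivRange φA)).trans (RingEquiv.subringCongr hr)⟩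
end
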